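/- Let κ and τ be nonnegative integers with τ > 0. If μ = κ − τ is a main eigenvalue of a graph G, then G has no (κ,τ)-regular set. -/

import Mathlib

open SimpleGraph Matrix

/-- `S` is a `(κ,τ)`-regular set of `G`: every vertex in `S` has exactly `κ` neighbors in `S`
and every vertex outside `S` has exactly `τ` neighbors in `S`. -/
def IsKTRegular {V : Type*} (G : SimpleGraph V) (S : Set V) (κ τ : ℕ) : Prop :=
  (∀ v ∈ S, (G.neighborSet v ∩ S).ncard = κ) ∧ ∀ v ∉ S, (G.neighborSet v ∩ S).ncard = τ

/-- The characteristic (0-1) vector of a vertex subset. -/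
noncomputable def charVec {V : Type*} (S : Set V) : V → ℝ := S.indicator 1

/-- `μ` is an eigenvalue of the real matrix `A`. -/
def IsAdjEigenvalue {n : ℕ} (A : Matrix (Fin n) (Fin n) ℝ) (μ : ℝ) : Prop :=
  ∃ v : Fin n → ℝ, v ≠ 0 ∧ A.mulVec v = μ • v

/-- `μ` is a main eigenvalue of `A`: the eigenspace of `μ` is not orthogonal to the
all-ones vector, i.e. there is an eigenvector `u` for `μ` with `uᵀ𝟙 ≠ 0`. -/
def IsMainEigenvalue {n : ℕ} (A : Matrix (Fin n) (Fin n) ℝ) (μ : ℝ) : Prop :=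
  ∃ u : Fin n → ℝ, u ≠ 0 ∧ A.mulVec u = μ • u ∧ dotProduct u (fun _ => (1 : ℝ)) ≠ 0

/-- A `(κ,τ)`-regular set has characteristic vector `x` with `A x = (κ - τ) x + τ 𝟙`. -/
theorem IsKTRegular.adjMatrix_mulVec_charVec {V : Type*} [Fintype V] {G : SimpleGraph V}
    [DecidableRel G.Adj] {S : Set V} {κ τ : ℕ} (h : IsKTRegular G S κ τ) :
    (G.adjMatrix ℝ) *ᵥ charVec S = ((κ : ℝ) - τ) • charVec S + (τ : ℝ) • fun _ => (1 : ℝ) := by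
  classical
  ext v
  have hcard : ((G.adjMatrix ℝ) *ᵥ charVec S) v = ((G.neighborSet v ∩ S).ncard : ℝ) := by
    rw [adjMatrix_mulVec_apply, Set.ncard_eq_toFinset_card']
    simp only [charVec, Set.indicator_apply, Pi.one_apply, Finset.sum_boole]
    congr 2
    ext w
    simp
  rw [hcard]
  by_cases hv : v ∈ S
  · simp [h.1 v hv, charVec, hv]
  · simp [h.2 v hv, charVec, hv]

/-- If `μ = κ - τ` (with `τ > 0`) is a main eigenvalue of `G`, then `G` has no
`(κ,τ)`-regular set. -/
theorem no_kt_regular_of_main_eigenvalue {n κ τ : ℕ} (G : SimpleGraph (Fin n))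
    [DecidableRel G.Adj] (hτ : 0 < τ)
    (hmain : IsMainEigenvalue (G.adjMatrix ℝ) ((κ : ℝ) - τ)) :
    ¬ ∃ S : Set (Fin n), IsKTRegular G S κ τ := by
  rintro ⟨S, hS⟩
  obtain ⟨u, -, hu, hsum⟩ := hmain
  have key : u ⬝ᵥ (G.adjMatrix ℝ) *ᵥ charVec S = ((κ : ℝ) - τ) * (u ⬝ᵥ charVec S) := by
    rw [dotProduct_mulVec, ← mulVec_transpose, transpose_adjMatrix, hu, smul_dotProduct,
      smul_eq_mul]
  rw [hS.adjMatrix_mulVec_charVec, dotProduct_add, dotProduct_smul, dotProduct_smul,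
    smul_eq_mul, smul_eq_mul, add_eq_left] at key
  exact mul_ne_zero (Nat.cast_ne_zero.mpr hτ.ne') hsum key
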